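/- arXiv:0907.0037 — 7 statements merged into one kernel-verified Lean document; each statement's English description precedes it below -/
import Mathlib

section
/- Let A be an associative unital ℂ-algebra with bilinear maps α_A, γ_A : A × A → A such that the product (a,b,c)*(a′,b′,c′) = (aa′, ab′+ba′+α_A(a,a′), ac′+bb′+ca′+α_A(a,b′)+α_A(b,a′)+γ_A(a,a′)) on A_{ε²} = A ⊕ εA ⊕ ε²A is associative. Let B be a right A-module and α_B, γ_B : B × A → B bilinear maps. Define a right action of A_{ε²} on B_{ε²} := B ⊕ εB ⊕ ε²B by (b, b₁, b₂)*(a, a₁, a₂) := (ba, ba₁ + b₁a + α_B(b,a), ba₂ + b₁a₁ + b₂a + α_B(b,a₁) + α_B(b₁,a) + γ_B(b,a)). Then this action makes B_{ε²} a right A_{ε²}-module if and only if α_B(ba₁,a₂) − α_B(b,a₁a₂) + α_B(b,a₁)a₂ − bα_A(a₁,a₂) = 0 and α_B(α_B(b,a₁),a₂) − α_B(b,α_A(a₁,a₂)) + γ_B(ba₁,a₂) − γ_B(b,a₁a₂) + γ_B(b,a₁)a₂ − bγ_A(a₁,a₂) = 0 for all b ∈ B, a₁, a₂ ∈ A. 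-/
/-- The second-order deformed product on `A_{ε²} = A ⊕ εA ⊕ ε²A`. -/
def defProd₂ {A : Type*} [Ring A] (αA γA : A → A → A) (x y : A × A × A) : A × A × A :=
  (x.1 * y.1,
    x.1 * y.2.1 + x.2.1 * y.1 + αA x.1 y.1,
    x.1 * y.2.2 + x.2.1 * y.2.1 + x.2.2 * y.1 + αA x.1 y.2.1 + αA x.2.1 y.1 + γA x.1 y.1)

/-- The second-order deformed right action of `A_{ε²}` on `B_{ε²} = B ⊕ εB ⊕ ε²B`, where
`B` is a right `A`-module (encoded as an `Aᵐᵒᵖ`-module):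
`(b,b₁,b₂) * (a,a₁,a₂) := (ba, ba₁ + b₁a + α_B(b,a),
  ba₂ + b₁a₁ + b₂a + α_B(b,a₁) + α_B(b₁,a) + γ_B(b,a))`. -/
def defAct₂ {A B : Type*} [Ring A] [AddCommGroup B] [Module Aᵐᵒᵖ B]
    (αB γB : B → A → B) (m : B × B × B) (x : A × A × A) : B × B × B :=
  (MulOpposite.op x.1 • m.1,
    MulOpposite.op x.2.1 • m.1 + MulOpposite.op x.1 • m.2.1 + αB m.1 x.1,
    MulOpposite.op x.2.2 • m.1 + MulOpposite.op x.2.1 • m.2.1 + MulOpposite.op x.1 • m.2.2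
      + αB m.1 x.2.1 + αB m.2.1 x.1 + γB m.1 x.1)

/-- Given a second-order deformation `(α_A, γ_A)` of `A` (i.e. the product
on `A_{ε²}` is associative), the second-order deformed action of `A_{ε²}` on `B_{ε²}` is
associative (makes `B_{ε²}` a right `A_{ε²}`-module) if and only if `α_B` satisfies the
first-order module cocycle condition and `(α_B, γ_B)` satisfies the second-order
integrability condition. -/
theorem second_order_module_deformation_iff
    {K A B : Type*} [Field K] [CharZero K] [Ring A] [Algebra K A]
    [AddCommGroup B] [Module K B] [Module Aᵐᵒᵖ B]
    (αA γA : A →ₗ[K] A →ₗ[K] A)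
    (hassoc : ∀ x y z : A × A × A,
      defProd₂ (fun a b => αA a b) (fun a b => γA a b)
          (defProd₂ (fun a b => αA a b) (fun a b => γA a b) x y) z =
        defProd₂ (fun a b => αA a b) (fun a b => γA a b) x
          (defProd₂ (fun a b => αA a b) (fun a b => γA a b) y z))
    (αB γB : B →ₗ[K] A →ₗ[K] B) :
    (∀ (m : B × B × B) (x y : A × A × A),
        defAct₂ (fun b a => αB b a) (fun b a => γB b a)
            (defAct₂ (fun b a => αB b a) (fun b a => γB b a) m x) y =
          defAct₂ (fun b a => αB b a) (fun b a => γB b a) m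
            (defProd₂ (fun a b => αA a b) (fun a b => γA a b) x y)) ↔
      ((∀ (b : B) (a₁ a₂ : A),
          αB (MulOpposite.op a₁ • b) a₂ - αB b (a₁ * a₂)
            + MulOpposite.op a₂ • (αB b a₁) - MulOpposite.op (αA a₁ a₂) • b = 0) ∧
        (∀ (b : B) (a₁ a₂ : A),
          αB (αB b a₁) a₂ - αB b (αA a₁ a₂)
            + γB (MulOpposite.op a₁ • b) a₂ - γB b (a₁ * a₂)
            + MulOpposite.op a₂ • (γB b a₁) - MulOpposite.op (γA a₁ a₂) • b = 0)) := by
  simp only [defProd₂, defAct₂, Prod.ext_iff]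
  constructor
  · intro h
    refine ⟨fun b a₁ a₂ => ?_, fun b a₁ a₂ => ?_⟩
    · have h₁ := (h (b, 0, 0) (a₁, 0, 0) (a₂, 0, 0)).2.1
      simp only [MulOpposite.op_zero, zero_smul, smul_zero, mul_zero, zero_mul, zero_add,
        add_zero] at h₁
      linear_combination (norm := abel) h₁
    · have h₂ := (h (b, 0, 0) (a₁, 0, 0) (a₂, 0, 0)).2.2
      simp only [MulOpposite.op_zero, zero_smul, smul_zero, mul_zero, zero_mul, zero_add,
        add_zero, map_zero, LinearMap.zero_apply] at h₂
      linear_combination (norm := abel) h₂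
  · rintro ⟨h₁, h₂⟩ ⟨b, b₁, b₂⟩ ⟨a, a₁, a₂⟩ ⟨c, c₁, c₂⟩
    refine ⟨?_, ?_, ?_⟩
    · simp only [MulOpposite.op_mul, mul_smul]
    · simp only [MulOpposite.op_mul, MulOpposite.op_add, mul_smul, add_smul, smul_add]
      linear_combination (norm := abel) h₁ b a c
    · simp only [MulOpposite.op_mul, MulOpposite.op_add, mul_smul, add_smul, smul_add, map_add,
        LinearMap.add_apply]
      linear_combination (norm := abel) h₁ b a c₁ + h₁ b a₁ c + h₁ b₁ a c + h₂ b a c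
end

section
/- Let A be a commutative unital ℂ-algebra and α_A : A × A → A a skew-symmetric ℂ-bilinear Hochschild 2-cocycle (α_A(a₁,a₂) = −α_A(a₂,a₁) and α_A(a₁a₂,a₃) − α_A(a₁,a₂a₃) + α_A(a₁,a₂)a₃ − a₁α_A(a₂,a₃) = 0). Let C be an A-module and α_C : A × C → C a bilinear map satisfying the left-module cocycle condition α_A(a₁,a₂)c + α_C(a₁a₂,c) − a₁α_C(a₂,c) − α_C(a₁,a₂c) = 0 for all a₁,a₂ ∈ A, c ∈ C. Then the transposed cochain α_C^t : C × A → C defined by α_C^t(c,a) := −α_C(a,c) satisfies the right-module cocycle condition α_C^t(ca₂,a₃) − α_C^t(c,a₂a₃) + α_C^t(c,a₂)a₃ − cα_A(a₂,a₃) = 0 for all c ∈ C, a₂, a₃ ∈ A. Hence α_C^t defines a first-order deformation of C to a right module over the deformed algebra A_ε determined by α_A. -/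
/-- Let `A` be a commutative unital algebra over a field `K` of
characteristic zero, `α_A` a skew-symmetric Hochschild 2-cocycle on `A`, `C` an
`A`-module and `α_C : A × C → C` a cochain satisfying the left-module cocycle condition.
Then the transposed cochain `α_C^t(c,a) := −α_C(a,c)` satisfies the right-module cocycle
condition, hence defines a first-order deformation of `C` to a right module over the
deformed algebra `A_ε` determined by `α_A`. -/
theorem transposed_deformation_is_right_module_cocycle
    {K A C : Type*} [Field K] [CharZero K] [CommRing A] [Algebra K A]
    [AddCommGroup C] [Module K C] [Module A C]
    (αA : A →ₗ[K] A →ₗ[K] A)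
    (hskew : ∀ a₁ a₂ : A, αA a₁ a₂ = -αA a₂ a₁)
    (hαA : ∀ a₁ a₂ a₃ : A,
      αA (a₁ * a₂) a₃ - αA a₁ (a₂ * a₃) + αA a₁ a₂ * a₃ - a₁ * αA a₂ a₃ = 0)
    (αC : A →ₗ[K] C →ₗ[K] C)
    (hαC : ∀ (a₁ a₂ : A) (c : C),
      (αA a₁ a₂) • c + αC (a₁ * a₂) c - a₁ • (αC a₂ c) - αC a₁ (a₂ • c) = 0)
    (αCt : C → A → C)
    (hαCt : ∀ (c : C) (a : A), αCt c a = -αC a c) :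
    ∀ (c : C) (a₂ a₃ : A),
      αCt (a₂ • c) a₃ - αCt c (a₂ * a₃) + a₃ • (αCt c a₂) - (αA a₂ a₃) • c = 0 := by
  intro c a₂ a₃
  rw [← hαC a₃ a₂ c, hαCt, hαCt, hαCt, hskew a₂ a₃, mul_comm a₂ a₃, neg_smul, smul_neg]
  abel
end

section
/- Let D = D₀ ⊕ D₁ be a ℤ/2-graded associative unital ℂ-algebra, |x| the parity of a homogeneous element x, δ : D → D an odd ℂ-linear map with δ(1) = 0, and define the bracket [x,y] := δ(xy) − δ(x)y − (−1)^{|x|}xδ(y) for homogeneous x, y. Let d : D → D be an odd ℂ-linear derivation, i.e. d(D_i) ⊆ D_{i+1} and d(xy) = d(x)y + (−1)^{|x|}x d(y), and write [d,δ]₊ := dδ + δd. Then for all homogeneous x, y ∈ D: d[x,y] + [dx, y] + (−1)^{|x|}[x, dy] = [d,δ]₊(xy) − [d,δ]₊(x)·y − x·[d,δ]₊(y). In particular, if dδ + δd = 0, then d[x,y] = −[dx,y] − (−1)^{|x|}[x,dy], so the bracket descends to the cohomology of d. -/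
/-- The sign `(−1)^i` attached to a parity `i ∈ ℤ/2`, valued in the base field `K`. -/
def gSign (K : Type*) [Field K] (i : ZMod 2) : K := (-1 : K) ^ i.val

/-- The BV-type bracket generated by an operator `δ`:
`[x,y] := δ(xy) − δ(x)y − (−1)^{|x|} x δ(y)`, where `s = (−1)^{|x|}` is the sign attached
to the parity of the (homogeneous) first argument `x`. -/
def bvBracket {K D : Type*} [Field K] [Ring D] [Algebra K D]
    (δ : D → D) (s : K) (x y : D) : D :=
  δ (x * y) - δ x * y - s • (x * δ y)

theorem gSign_add_one (K : Type*) [Field K] (i : ZMod 2) : gSign K (i + 1) = -gSign K i := by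
  fin_cases i
  · change (-1 : K) ^ 1 = -(-1 : K) ^ 0
    simp
  · change (-1 : K) ^ 0 = -(-1 : K) ^ 1
    simp

theorem gSign_smul_gSign_smul {K D : Type*} [Field K] [AddCommGroup D] [Module K D]
    (i : ZMod 2) (x : D) : gSign K i • gSign K i • x = x := by
  rw [smul_smul, gSign, ← mul_pow]
  simp

/-- Let `D = D₀ ⊕ D₁` be a `ℤ/2`-graded associative unital algebra over a
field `K` of characteristic zero, `δ` an odd linear map with `δ(1) = 0`, and `d` an odd
derivation.  Then for homogeneous `x, y`,
`d[x,y] + [dx,y] + (−1)^{|x|}[x,dy] = [d,δ]₊(xy) − [d,δ]₊(x)y − x[d,δ]₊(y)`.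
In particular, if `dδ + δd = 0` the bracket descends to the cohomology of `d`. -/
theorem bvBracket_derivation_compatibility
    {K D : Type*} [Field K] [CharZero K] [Ring D] [Algebra K D]
    (𝒜 : ZMod 2 → Submodule K D) [GradedAlgebra 𝒜]
    (δ d : D →ₗ[K] D)
    (hδ1 : δ 1 = 0)
    (hδodd : ∀ (i : ZMod 2), ∀ x ∈ 𝒜 i, δ x ∈ 𝒜 (i + 1))
    (hdodd : ∀ (i : ZMod 2), ∀ x ∈ 𝒜 i, d x ∈ 𝒜 (i + 1))
    (hder : ∀ (i : ZMod 2) (x y : D), x ∈ 𝒜 i →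
      d (x * y) = d x * y + gSign K i • (x * d y)) :
    (∀ (i j : ZMod 2) (x y : D), x ∈ 𝒜 i → y ∈ 𝒜 j →
        d (bvBracket (⇑δ) (gSign K i) x y)
          + bvBracket (⇑δ) (gSign K (i + 1)) (d x) y
          + gSign K i • bvBracket (⇑δ) (gSign K i) x (d y)
        = (d (δ (x * y)) + δ (d (x * y)))
            - (d (δ x) + δ (d x)) * y - x * (d (δ y) + δ (d y))) ∧
      ((∀ w : D, d (δ w) + δ (d w) = 0) →
        ∀ (i j : ZMod 2) (x y : D), x ∈ 𝒜 i → y ∈ 𝒜 j →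
          d (bvBracket (⇑δ) (gSign K i) x y)
            = -bvBracket (⇑δ) (gSign K (i + 1)) (d x) y
              - gSign K i • bvBracket (⇑δ) (gSign K i) x (d y)) := by
  have key : ∀ (i : ZMod 2) (x y : D), x ∈ 𝒜 i →
      d (bvBracket (⇑δ) (gSign K i) x y)
        + bvBracket (⇑δ) (gSign K (i + 1)) (d x) y
        + gSign K i • bvBracket (⇑δ) (gSign K i) x (d y)
      = (d (δ (x * y)) + δ (d (x * y)))
          - (d (δ x) + δ (d x)) * y - x * (d (δ y) + δ (d y)) := by
    intro i x y hx
    simp only [bvBracket, map_sub, map_smul, map_add, hder i x _ hx,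
      hder (i + 1) (δ x) y (hδodd i x hx), gSign_add_one, smul_sub, smul_add, neg_smul,
      gSign_smul_gSign_smul, add_mul, mul_add]
    abel
  refine ⟨fun i _ x y hx _ => key i x y hx, fun h i _ x y hx _ => ?_⟩
  have hxy := key i x y hx
  simp only [h, zero_mul, mul_zero, sub_zero] at hxy
  rw [eq_neg_of_add_eq_zero_left ((add_assoc _ _ _).symm.trans hxy)]
  abel
end

section
/- Let k be a field of characteristic zero, A a commutative unital k-algebra, B a right A-module and C a left A-module. For i ≥ 0 set T_i := B ⊗_k A^{⊗i} ⊗_k C, with bar differential d_T(b⊗a₁⊗…⊗a_i⊗c) = ba₁⊗a₂⊗…⊗a_i⊗c + Σ_{s=1}^{i−1}(−1)^s b⊗a₁⊗…⊗a_sa_{s+1}⊗…⊗a_i⊗c + (−1)^i b⊗a₁⊗…⊗a_{i−1}⊗a_ic. Given k-bilinear maps α_A : A×A→A, α_B : B×A→B, α_C : A×C→C, define δ_α : T_i → T_{i−1} by δ_α(b⊗a₁⊗…⊗a_i⊗c) = α_B(b,a₁)⊗a₂⊗…⊗a_i⊗c + Σ_{s=1}^{i−1}(−1)^s b⊗a₁⊗…⊗α_A(a_s,a_{s+1})⊗…⊗a_i⊗c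 + (−1)^i b⊗a₁⊗…⊗a_{i−1}⊗α_C(a_i,c). Suppose α_A satisfies the Hochschild 2-cocycle condition α_A(a₁a₂,a₃) − α_A(a₁,a₂a₃) + α_A(a₁,a₂)a₃ − a₁α_A(a₂,a₃) = 0, α_B satisfies α_B(ba₂,a₃) − α_B(b,a₂a₃) + α_B(b,a₂)a₃ − bα_A(a₂,a₃) = 0, and α_C satisfies α_A(a₁,a₂)c + α_C(a₁a₂,c) − a₁α_C(a₂,c) − α_C(a₁,a₂c) = 0. Then δ_α d_T + d_T δ_α = 0 on every T_i. -/
open TensorProduct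

universe u
variable {k A B C : Type u}
variable [Field k] [CharZero k]
variable [CommRing A] [Algebra k A]
variable [AddCommGroup C] [Module k C] [Module A C] [IsScalarTower k A C]
variable [AddCommGroup B] [Module k B] [Module A B] [IsScalarTower k A B]

/-- The iterated tensor product `A^{⊗n} ⊗ C`, bundled as a `k`-module. -/
noncomputable def barM (k A C : Type u) [Field k] [CommRing A] [Algebra k A]
    [AddCommGroup C] [Module k C] : ℕ → ModuleCat k
  | 0 => ModuleCat.of k C
  | (n + 1) => ModuleCat.of k (A ⊗[k] (barM k A C n))

/-- The "inner" bar-type contraction `A^{⊗(n+1)} ⊗ C → A^{⊗n} ⊗ C` determined by a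
bilinear "product" `mA` on `A` and a bilinear "action" `mC : A × C → C`; on pure tensors
`a₁ ⊗ … ⊗ a_{n+1} ⊗ c` it is
`Σ_{s=1}^{n} (−1)^{s−1} a₁⊗…⊗ mA(a_s,a_{s+1}) ⊗…⊗ c + (−1)^n a₁⊗…⊗a_n⊗ mC(a_{n+1},c)`. -/
noncomputable def barInner (mA : A →ₗ[k] A →ₗ[k] A) (mC : A →ₗ[k] C →ₗ[k] C) :
    ∀ n, (barM k A C (n + 1) : Type u) →ₗ[k] (barM k A C n : Type u)
  | 0 => TensorProduct.lift mC
  | (n + 1) =>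
      (TensorProduct.map (TensorProduct.lift mA) LinearMap.id).comp
          (TensorProduct.assoc k A A (barM k A C n)).symm.toLinearMap
        - TensorProduct.map LinearMap.id (barInner mA mC n)

/-- The chain group `T_n = B ⊗ A^{⊗n} ⊗ C`. -/
noncomputable def barT (k A B C : Type u) [Field k] [CommRing A] [Algebra k A]
    [AddCommGroup C] [Module k C] [AddCommGroup B] [Module k B] (n : ℕ) : Type u :=
  B ⊗[k] (barM k A C n)

noncomputable instance (n : ℕ) : AddCommGroup (barT k A B C n) :=
  inferInstanceAs (AddCommGroup (B ⊗[k] (barM k A C n)))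
noncomputable instance (n : ℕ) : Module k (barT k A B C n) :=
  inferInstanceAs (Module k (B ⊗[k] (barM k A C n)))

/-- The bar-type degree `−1` operator `T_{n+1} → T_n` determined by bilinear maps
`mB : B × A → B`, `mA : A × A → A`, `mC : A × C → C`; on pure tensors it is
`b⊗a₁⊗…⊗a_{n+1}⊗c ↦ mB(b,a₁)⊗a₂⊗…⊗c + Σ_{s=1}^{n}(−1)^s b⊗…⊗mA(a_s,a_{s+1})⊗…⊗c
 + (−1)^{n+1} b⊗a₁⊗…⊗a_n⊗mC(a_{n+1},c)`.
For `mB, mA, mC` the structure maps (right action on `B`, product of `A`, left action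
on `C`) this is the bar differential `d_T`; for a triple of deformation cochains
`(α_B, α_A, α_C)` it is the operator `δ_α`. -/
noncomputable def barOp (mB : B →ₗ[k] A →ₗ[k] B) (mA : A →ₗ[k] A →ₗ[k] A)
    (mC : A →ₗ[k] C →ₗ[k] C) (n : ℕ) :
    barT k A B C (n + 1) →ₗ[k] barT k A B C n :=
  (TensorProduct.map (TensorProduct.lift mB) LinearMap.id).comp
      (TensorProduct.assoc k B A (barM k A C n)).symm.toLinearMap
    - TensorProduct.map LinearMap.id (barInner mA mC n)

/-- The right action of `A` on `B` as a `k`-bilinear map. -/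
noncomputable def ractB : B →ₗ[k] A →ₗ[k] B :=
  LinearMap.mk₂ k (fun b a => a • b)
    (fun b b' a => smul_add a b b')
    (fun c b a => smul_comm a c b)
    (fun b a a' => add_smul a a' b)
    (fun c b a => smul_assoc c a b)

/-- The multiplication of `A` as a `k`-bilinear map. -/
noncomputable def mulA : A →ₗ[k] A →ₗ[k] A := LinearMap.mul k A

/-- The left action of `A` on `C` as a `k`-bilinear map. -/
noncomputable def lactC : A →ₗ[k] C →ₗ[k] C :=
  LinearMap.mk₂ k (fun a c => a • c)
    (fun a a' c => add_smul a a' c)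
    (fun r a c => smul_assoc r a c)
    (fun a c c' => smul_add a c c')
    (fun r a c => smul_comm a r c)


/-- The contraction `P ⊗ (A ⊗ X) → P ⊗ X` sending `p ⊗ (a ⊗ x)` to
`m p a ⊗ x - p ⊗ f (a ⊗ x)`. -/
noncomputable def barStep {k A P X : Type*} [CommRing k] [AddCommGroup A] [Module k A]
    [AddCommGroup P] [Module k P] [AddCommGroup X] [Module k X]
    (m : P →ₗ[k] A →ₗ[k] P) (f : A ⊗[k] X →ₗ[k] X) : P ⊗[k] (A ⊗[k] X) →ₗ[k] P ⊗[k] X :=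
  (TensorProduct.map (TensorProduct.lift m) LinearMap.id).comp
      (TensorProduct.assoc k P A X).symm.toLinearMap
    - TensorProduct.map LinearMap.id f

theorem barStep_tmul {k A P X : Type*} [CommRing k] [AddCommGroup A] [Module k A]
    [AddCommGroup P] [Module k P] [AddCommGroup X] [Module k X]
    (m : P →ₗ[k] A →ₗ[k] P) (f : A ⊗[k] X →ₗ[k] X) (p : P) (a : A) (x : X) :
    barStep m f (p ⊗ₜ[k] (a ⊗ₜ[k] x)) = m p a ⊗ₜ[k] x - p ⊗ₜ[k] f (a ⊗ₜ[k] x) := by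
  simp [barStep]

theorem barStep_comp_barStep_tmul {k A P X : Type*} [CommRing k] [AddCommGroup A] [Module k A]
    [AddCommGroup P] [Module k P] [AddCommGroup X] [Module k X]
    (m m' : P →ₗ[k] A →ₗ[k] P) (μ' : A →ₗ[k] A →ₗ[k] A) (f f' : A ⊗[k] X →ₗ[k] X)
    (p : P) (a₁ a₂ : A) (x : X) :
    barStep m f (barStep m' (barStep μ' f') (p ⊗ₜ[k] (a₁ ⊗ₜ[k] (a₂ ⊗ₜ[k] x)))) =
      (m (m' p a₁) a₂ - m p (μ' a₁ a₂)) ⊗ₜ[k] x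
        - m' p a₁ ⊗ₜ[k] f (a₂ ⊗ₜ[k] x) + m p a₁ ⊗ₜ[k] f' (a₂ ⊗ₜ[k] x)
        + p ⊗ₜ[k] f (barStep μ' f' (a₁ ⊗ₜ[k] (a₂ ⊗ₜ[k] x))) := by
  simp only [barStep_tmul, TensorProduct.tmul_sub, TensorProduct.sub_tmul, map_sub]
  abel

theorem barStep_anticommute {k A P X : Type*} [CommRing k] [AddCommGroup A] [Module k A]
    [AddCommGroup P] [Module k P] [AddCommGroup X] [Module k X]
    {m m' : P →ₗ[k] A →ₗ[k] P} {μ μ' : A →ₗ[k] A →ₗ[k] A} {f f' : A ⊗[k] X →ₗ[k] X}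
    (hm : ∀ p a₁ a₂, m (m' p a₁) a₂ - m p (μ' a₁ a₂) + m' (m p a₁) a₂ - m' p (μ a₁ a₂) = 0)
    (hf : f.comp (barStep μ' f') + f'.comp (barStep μ f) = 0) :
    (barStep m f).comp (barStep m' (barStep μ' f'))
      + (barStep m' f').comp (barStep m (barStep μ f)) = 0 := by
  ext p a₁ a₂ x
  have hfx := congrArg (p ⊗ₜ[k] ·) (LinearMap.congr_fun hf (a₁ ⊗ₜ[k] (a₂ ⊗ₜ[k] x)))
  have hmx := congrArg (· ⊗ₜ[k] x) (hm p a₁ a₂)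
  simp only [LinearMap.add_apply, LinearMap.comp_apply, LinearMap.zero_apply,
    TensorProduct.tmul_add, TensorProduct.tmul_zero] at hfx
  simp only [TensorProduct.add_tmul, TensorProduct.sub_tmul, TensorProduct.zero_tmul] at hmx
  simp only [TensorProduct.AlgebraTensorModule.curry_apply, TensorProduct.curry_apply,
    LinearMap.restrictScalars_self, LinearMap.add_apply, LinearMap.comp_apply,
    LinearMap.zero_apply, barStep_comp_barStep_tmul,
    TensorProduct.sub_tmul]
  refine Eq.trans ?_ ((congrArg₂ (· + ·) hmx hfx).trans (add_zero 0))
  abel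

theorem barInner_anticommute {k A C : Type u} [Field k] [CommRing A] [Algebra k A]
    [AddCommGroup C] [Module k C] {μ μ' : A →ₗ[k] A →ₗ[k] A} {l l' : A →ₗ[k] C →ₗ[k] C}
    (hμ : ∀ a₁ a₂ a₃, μ (μ' a₁ a₂) a₃ - μ a₁ (μ' a₂ a₃) + μ' (μ a₁ a₂) a₃ - μ' a₁ (μ a₂ a₃) = 0)
    (hl : ∀ a₁ a₂ c, l (μ' a₁ a₂) c - l a₁ (l' a₂ c) + l' (μ a₁ a₂) c - l' a₁ (l a₂ c) = 0)
    (n : ℕ) :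
    (barInner μ l n).comp (barInner μ' l' (n + 1))
      + (barInner μ' l' n).comp (barInner μ l (n + 1)) = 0 := by
  induction n with
  | zero =>
    change (TensorProduct.lift l).comp (barStep μ' (TensorProduct.lift l'))
      + (TensorProduct.lift l').comp (barStep μ (TensorProduct.lift l)) = 0
    ext a₁ a₂ c
    simpa [barStep_tmul, add_sub_assoc] using hl a₁ a₂ c
  | succ n ih => exact barStep_anticommute hμ ih

/-- (Lemma "operations (1)".)  Let `k` be a field of characteristic
zero, `A` a commutative unital `k`-algebra, `B` and `C` `A`-modules (a right and a left
module).  If `α_A` is a Hochschild 2-cocycle, `α_B` satisfies the right-module cocycle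
condition and `α_C` the left-module cocycle condition, then the bar-type operator
`δ_α` anticommutes with the bar differential `d_T` on every `T_i = B ⊗ A^{⊗i} ⊗ C`:
`δ_α d_T + d_T δ_α = 0`. -/
theorem bar_delta_anticommutes_with_differential
    (αA : A →ₗ[k] A →ₗ[k] A) (αB : B →ₗ[k] A →ₗ[k] B) (αC : A →ₗ[k] C →ₗ[k] C)
    (hA : ∀ a₁ a₂ a₃ : A,
      αA (a₁ * a₂) a₃ - αA a₁ (a₂ * a₃) + αA a₁ a₂ * a₃ - a₁ * αA a₂ a₃ = 0)
    (hB : ∀ (b : B) (a₂ a₃ : A),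
      αB (a₂ • b) a₃ - αB b (a₂ * a₃) + a₃ • (αB b a₂) - (αA a₂ a₃) • b = 0)
    (hC : ∀ (a₁ a₂ : A) (c : C),
      (αA a₁ a₂) • c + αC (a₁ * a₂) c - a₁ • (αC a₂ c) - αC a₁ (a₂ • c) = 0) :
    ∀ n : ℕ,
      (barOp αB αA αC n).comp (barOp (ractB (k := k)) (mulA (k := k)) (lactC (k := k)) (n + 1))
        + (barOp (ractB (k := k)) (mulA (k := k)) (lactC (k := k)) n).comp (barOp αB αA αC (n + 1)) = 0 := by
  intro n
  refine barStep_anticommute (fun b a₁ a₂ => hB b a₁ a₂)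
    (barInner_anticommute (fun a₁ a₂ a₃ => hA a₁ a₂ a₃) (fun a₁ a₂ c => ?_) n)
  simp only [mulA, lactC, LinearMap.mul_apply', LinearMap.mk₂_apply]
  rw [← hC a₁ a₂ c]
  abel
end

section
/- Let A be a commutative unital ℂ-algebra and α : A × A → A an alternating ℂ-bilinear Hochschild 2-cocycle (α(a,b) = −α(b,a) and α(a₁a₂,a₃) − α(a₁,a₂a₃) + α(a₁,a₂)a₃ − a₁α(a₂,a₃) = 0). Suppose γ : A × A → A is a ℂ-bilinear map satisfying α(α(a₁,a₂),a₃) − α(a₁,α(a₂,a₃)) = γ(a₁a₂,a₃) − γ(a₁,a₂a₃) + γ(a₁,a₂)a₃ − a₁γ(a₂,a₃) for all a₁,a₂,a₃. Then the symmetrization γ^s(a,b) := (γ(a,b) + γ(b,a))/2 satisfies the same equation: α(α(a₁,a₂),a₃) − α(a₁,α(a₂,a₃)) = γ^s(a₁a₂,a₃) − γ^s(a₁,a₂a₃) + γ^s(a₁,a₂)a₃ − a₁γ^s(a₂,a₃). Hence if a first-order deformation of A given by an alternating 2-cocycle extends to second order, the second-order cochain can be chosen symmetric. -/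
/-- Let `A` be a commutative unital algebra over a field `K` of
characteristic zero, `α` an alternating bilinear Hochschild 2-cocycle and `γ` a bilinear
map such that `α(α(a₁,a₂),a₃) − α(a₁,α(a₂,a₃))` is the Hochschild coboundary of `γ`.
Then the symmetrization `γ^s(a,b) := (γ(a,b) + γ(b,a))/2` satisfies the same equation;
hence the second-order cochain extending the deformation can be chosen symmetric. -/
theorem symmetrized_second_order_cochain
    {K A : Type*} [Field K] [CharZero K] [CommRing A] [Algebra K A]
    (α : A →ₗ[K] A →ₗ[K] A)
    (halt : ∀ a b : A, α a b = -α b a)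
    (hcocycle : ∀ a₁ a₂ a₃ : A,
      α (a₁ * a₂) a₃ - α a₁ (a₂ * a₃) + α a₁ a₂ * a₃ - a₁ * α a₂ a₃ = 0)
    (γ : A →ₗ[K] A →ₗ[K] A)
    (hγ : ∀ a₁ a₂ a₃ : A,
      α (α a₁ a₂) a₃ - α a₁ (α a₂ a₃)
        = γ (a₁ * a₂) a₃ - γ a₁ (a₂ * a₃) + γ a₁ a₂ * a₃ - a₁ * γ a₂ a₃)
    (γs : A → A → A)
    (hγs : ∀ a b : A, γs a b = (2⁻¹ : K) • (γ a b + γ b a)) :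
    ∀ a₁ a₂ a₃ : A,
      α (α a₁ a₂) a₃ - α a₁ (α a₂ a₃)
        = γs (a₁ * a₂) a₃ - γs a₁ (a₂ * a₃) + γs a₁ a₂ * a₃ - a₁ * γs a₂ a₃ := by
  intro a₁ a₂ a₃
  have hreverse : α (α a₃ a₂) a₁ - α a₃ (α a₂ a₁)
      = -(α (α a₁ a₂) a₃ - α a₁ (α a₂ a₃)) := by
    rw [halt (α a₃ a₂) a₁, halt a₃ (α a₂ a₁), halt a₃ a₂, halt a₂ a₁]
    simp only [map_neg, LinearMap.neg_apply]
    ring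
  have hop : α (α a₁ a₂) a₃ - α a₁ (α a₂ a₃)
      = γ a₃ (a₁ * a₂) - γ (a₂ * a₃) a₁ + γ a₂ a₁ * a₃ - a₁ * γ a₃ a₂ := by
    have h := hγ a₃ a₂ a₁
    rw [hreverse, mul_comm a₃ a₂, mul_comm a₂ a₁] at h
    linear_combination -h
  have hsum : γs (a₁ * a₂) a₃ - γs a₁ (a₂ * a₃) + γs a₁ a₂ * a₃ - a₁ * γs a₂ a₃
      = (2⁻¹ : K) • ((α (α a₁ a₂) a₃ - α a₁ (α a₂ a₃))
        + (α (α a₁ a₂) a₃ - α a₁ (α a₂ a₃))) := by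
    simp only [hγs, smul_mul_assoc, mul_smul_comm, ← smul_sub, ← smul_add]
    congr 1
    linear_combination -hγ a₁ a₂ a₃ - hop
  rw [hsum, ← two_smul K, inv_smul_smul₀ two_ne_zero]
end

section
/- Let A be a smooth commutative ℂ-algebra of finite type (the coordinate ring of a smooth affine variety X over ℂ), I ⊆ A an ideal such that B := A/I is also a smooth ℂ-algebra of finite type (the coordinate ring of a smooth closed subvariety Y ⊆ X), and let π : A → B be the quotient map. Let P : A × A → A be an alternating ℂ-bilinear map which is a derivation in each argument (a bivector field on X), and set α_A(a₁,a₂) := (1/2)P(a₁,a₂). Then the following are equivalent: (1) Y is coisotropic with respect to P, i.e. P(x,y) ∈ I for all x, y ∈ I; (2) there exists a ℂ-bilinear map α_B : B × A → B such that for all b ∈ B and a₂, a₃ ∈ A: α_B(b·π(a₂), a₃) − α_B(b, a₂a₃) + α_B(b, a₂)·π(a₃) − b·π(α_A(a₂,a₃)) = 0; that is, the first-order deformation of A determined by α_A admits a compatible first-order deformation of B to a right module. -/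
universe u

/-- If `A ⧸ I` is formally smooth over a field `K`, the projection `A → A ⧸ I` has a `K`-linear
section which is multiplicative modulo `I ^ 2`. -/
theorem Ideal.Quotient.exists_linear_section_mul_sub_mem_sq
    {K A : Type u} [Field K] [CommRing A] [Algebra K A]
    (I : Ideal A) [Algebra.FormallySmooth K (A ⧸ I)] :
    ∃ t : (A ⧸ I) →ₗ[K] A, (∀ b, Ideal.Quotient.mk I (t b) = b) ∧
      ∀ b c, t (b * c) - t b * t c ∈ I ^ 2 := by
  have hle : I ^ 2 ≤ I := Ideal.pow_le_self two_ne_zero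
  let g : (A ⧸ I ^ 2) →ₐ[K] (A ⧸ I) := Ideal.Quotient.factorₐ K hle
  have hg : Function.Surjective g := Ideal.Quotient.factor_surjective hle
  have hker : IsNilpotent (RingHom.ker (g : (A ⧸ I ^ 2) →+* (A ⧸ I))) := by
    refine ⟨2, ?_⟩
    have hk : RingHom.ker (g : (A ⧸ I ^ 2) →+* (A ⧸ I)) = I.map (Ideal.Quotient.mk (I ^ 2)) :=
      Ideal.Quotient.factor_ker hle
    rw [hk, ← Ideal.map_pow, Ideal.map_quotient_self, Ideal.zero_eq_bot]
  let s := Algebra.FormallySmooth.liftOfSurjective (AlgHom.id K (A ⧸ I)) g hg hker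
  have hs : ∀ b, g (s b) = b := fun b =>
    Algebra.FormallySmooth.liftOfSurjective_apply (AlgHom.id K (A ⧸ I)) g hg hker b
  obtain ⟨r, hr⟩ := (Ideal.Quotient.mkₐ K (I ^ 2)).toLinearMap.exists_rightInverse_of_surjective
    (LinearMap.range_eq_top.mpr (Ideal.Quotient.mkₐ_surjective K (I ^ 2)))
  have hr' : ∀ c, Ideal.Quotient.mk (I ^ 2) (r c) = c := fun c => LinearMap.congr_fun hr c
  refine ⟨r ∘ₗ s.toLinearMap, fun b => ?_, fun b c => ?_⟩
  · have h : g (Ideal.Quotient.mk (I ^ 2) (r (s b))) = b := by rw [hr', hs]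
    exact h
  · rw [← Ideal.Quotient.eq_zero_iff_mem]
    simp [hr']

/-- When `Ω[A⁄K]` is projective, a symmetrised biderivation is a Hochschild coboundary. -/
theorem KaehlerDifferential.exists_linearMap_mul_eq
    {K A M : Type*} [CommRing K] [CommRing A] [Algebra K A]
    [AddCommGroup M] [Module K M] [Module A M] [IsScalarTower K A M]
    [Module.Projective A (Ω[A⁄K])] (R : A →ₗ[K] Derivation K A M)
    (hR : ∀ a b c, R (a * b) c = a • R b c + b • R a c) :
    ∃ γ : A →ₗ[K] M, ∀ a b, γ (a * b) = a • γ b + b • γ a + R a b + R b a := by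
  obtain ⟨s, hs⟩ := Module.projective_def'.mp (inferInstance : Module.Projective A (Ω[A⁄K]))
  have hR' : ∀ a b (e : Ω[A⁄K]), (R (a * b)).liftKaehlerDifferential e =
      a • (R b).liftKaehlerDifferential e + b • (R a).liftKaehlerDifferential e := by
    intro a b e
    have h : (R (a * b)).liftKaehlerDifferential =
        a • (R b).liftKaehlerDifferential + b • (R a).liftKaehlerDifferential := by
      apply Derivation.liftKaehlerDifferential_unique
      ext c
      simp [hR]
    rw [h]
    rfl
  let S : (Ω[A⁄K]) → A →ₗ[K] M := fun e =>
    { toFun := fun a => (R a).liftKaehlerDifferential e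
      map_add' := fun a b => by
        have h : (R (a + b)).liftKaehlerDifferential =
            (R a).liftKaehlerDifferential + (R b).liftKaehlerDifferential := by
          apply Derivation.liftKaehlerDifferential_unique
          ext c
          simp
        rw [h]
        rfl
      map_smul' := fun k a => by
        have h : (R (k • a)).liftKaehlerDifferential =
            k • (R a).liftKaehlerDifferential := by
          apply Derivation.liftKaehlerDifferential_unique
          ext c
          simp
        rw [h]
        rfl }
  let L : ((Ω[A⁄K]) →₀ A) →ₗ[K] M := Finsupp.lsum K S
  have hL : ∀ (a : A) (v : (Ω[A⁄K]) →₀ A), L (a • v) =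
      a • L v + (R a).liftKaehlerDifferential (Finsupp.linearCombination A id v) := by
    intro a v
    induction v using Finsupp.induction_linear with
    | zero => simp
    | add v w hv hw =>
      rw [smul_add, map_add, hv, hw, map_add, map_add, map_add, smul_add]
      abel
    | single e c =>
      have hLs : ∀ a, L (Finsupp.single e a) = (R a).liftKaehlerDifferential e := fun a =>
        Finsupp.sum_single_index (S e).map_zero
      rw [Finsupp.smul_single, hLs, hLs, smul_eq_mul, hR', Finsupp.linearCombination_single,
        id, map_smul]
  have hs' : ∀ e, Finsupp.linearCombination A id (s e) = e := fun e => LinearMap.congr_fun hs e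
  refine ⟨L ∘ₗ s.restrictScalars K ∘ₗ (KaehlerDifferential.D K A).toLinearMap, fun a b => ?_⟩
  simp only [LinearMap.comp_apply, LinearMap.restrictScalars_apply, Derivation.coeFn_coe,
    Derivation.leibniz, map_add, map_smul, hL, hs',
    Derivation.liftKaehlerDifferential_comp_D]
  abel

/-- A coisotropic ideal with formally smooth quotient admits a first-order module deformation
compatible with the biderivation `½P`. -/
theorem exists_module_deformation_of_coisotropic
    {K A : Type u} [Field K] [CharZero K] [CommRing A] [Algebra K A]
    [Algebra.FormallySmooth K A]
    (I : Ideal A) [Algebra.FormallySmooth K (A ⧸ I)]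
    (P : A →ₗ[K] A →ₗ[K] A)
    (halt : ∀ a : A, P a a = 0)
    (hder₁ : ∀ a b c : A, P (a * b) c = a * P b c + b * P a c)
    (hder₂ : ∀ a b c : A, P a (b * c) = b * P a c + c * P a b)
    (hI : ∀ x ∈ I, ∀ y ∈ I, P x y ∈ I) :
    ∃ αB : (A ⧸ I) →ₗ[K] A →ₗ[K] (A ⧸ I),
      ∀ (b : A ⧸ I) (a₂ a₃ : A),
        αB (b * Ideal.Quotient.mk I a₂) a₃ - αB b (a₂ * a₃)
          + αB b a₂ * Ideal.Quotient.mk I a₃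
          - b * Ideal.Quotient.mk I ((2⁻¹ : K) • P a₂ a₃) = 0 := by
  obtain ⟨t, ht, htmul⟩ := Ideal.Quotient.exists_linear_section_mul_sub_mem_sq (K := K) I
  let π : A →ₐ[K] (A ⧸ I) := Ideal.Quotient.mkₐ K I
  have hπ : ∀ {x}, x ∈ I → π x = 0 := fun h => Ideal.Quotient.eq_zero_iff_mem.mpr h
  have hπt : ∀ b, π (t b) = b := ht
  have hsq₂ : ∀ a, ∀ x ∈ I ^ 2, π (P a x) = 0 := by
    intro a x hx
    rw [pow_two] at hx
    induction hx using Submodule.mul_induction_on' with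
    | mem_mul_mem y hy z hz => simp [hder₂, hπ hy, hπ hz]
    | add y _ z _ h₁ h₂ => simp [h₁, h₂]
  have hneg : ∀ a b, P a b = -P b a := fun a b => by
    have h := halt (a + b)
    simp only [map_add, LinearMap.add_apply, halt, zero_add, add_zero] at h
    exact eq_neg_of_add_eq_zero_right h
  have hsq₁ : ∀ a, ∀ x ∈ I ^ 2, π (P x a) = 0 := fun a x hx => by
    rw [hneg, map_neg, hsq₂ a x hx, neg_zero]
  let n : A →ₗ[K] A := LinearMap.id - t ∘ₗ π.toLinearMap
  have hn : ∀ a, n a = a - t (π a) := fun a => rfl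
  have hnI : ∀ a, n a ∈ I := fun a => by
    rw [← Ideal.Quotient.eq_zero_iff_mem]
    change π (n a) = 0
    rw [hn, map_sub, hπt, sub_self]
  have hnmul : ∀ a b, n (a * b) - (a * n b + b * n a) ∈ I ^ 2 := fun a b => by
    have h : n (a * b) - (a * n b + b * n a) =
        -(t (π a * π b) - t (π a) * t (π b)) - n a * n b := by
      simp only [hn, map_mul]
      ring
    rw [h]
    exact sub_mem (neg_mem (htmul _ _)) (pow_two I ▸ Ideal.mul_mem_mul (hnI a) (hnI b))
  have hPn : ∀ a b c, π (P a (n (b * c))) = π b * π (P a (n c)) + π c * π (P a (n b)) := by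
    intro a b c
    have h := hsq₂ a _ (hnmul b c)
    simp only [map_sub, map_add, hder₂, map_mul, hπ (hnI _), zero_mul, add_zero] at h
    exact sub_eq_zero.mp h
  have hPt : ∀ b c a, π (P (t (b * c)) a) = b * π (P (t c) a) + c * π (P (t b) a) := by
    intro b c a
    have h := hsq₁ a _ (htmul b c)
    simp only [map_sub, LinearMap.sub_apply, hder₁, map_add, map_mul, hπt] at h
    exact sub_eq_zero.mp h
  have hPtn : ∀ a b, π (P (t (π a)) (n b)) = π (P a (n b)) := fun a b => by
    have h := hπ (hI _ (hnI a) _ (hnI b))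
    rw [hn a, map_sub, LinearMap.sub_apply, map_sub] at h
    exact (sub_eq_zero.mp h).symm
  let R : A →ₗ[K] Derivation K A (A ⧸ I) :=
    { toFun := fun a => Derivation.mk' (π.toLinearMap ∘ₗ P a ∘ₗ n) fun b c => hPn a b c
      map_add' := fun a b => by ext c; exact congr_arg π (by simp) |>.trans (map_add π _ _)
      map_smul' := fun k a => by ext c; exact congr_arg π (by simp) |>.trans (map_smul π k _) }
  obtain ⟨γ, hγ⟩ := KaehlerDifferential.exists_linearMap_mul_eq R fun a b c => by
    change π (P (a * b) (n c)) = π a * π (P b (n c)) + π b * π (P a (n c))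
    simp [hder₁]
  replace hγ : ∀ a b, γ (a * b) = π a * γ b + π b * γ a + π (P a (n b)) + π (P b (n a)) := hγ
  let β : (A ⧸ I) →ₗ[K] A →ₗ[K] (A ⧸ I) :=
    (P ∘ₗ t).compr₂ π.toLinearMap + ((P ∘ₗ t).compl₂ n).compr₂ π.toLinearMap +
      (LinearMap.mul K (A ⧸ I)).compl₂ γ
  have hβ : ∀ b a, β b a = π (P (t b) a) + π (P (t b) (n a)) + b * γ a := fun b a => rfl
  have hcocycle : ∀ b a₂ a₃, β (b * π a₂) a₃ - β b (a₂ * a₃) + β b a₂ * π a₃ =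
      b * π (P a₂ a₃) := by
    intro b a₂ a₃
    have h : π (P (t (π a₂)) a₃) = π (P a₂ a₃) + π (P a₃ (n a₂)) := by
      rw [hneg a₃ (n a₂), hn, map_sub, LinearMap.sub_apply, map_neg, map_sub]
      ring
    simp only [hβ, hPt, hPn, hγ, hPtn, hder₂, map_add, map_mul, h]
    ring
  refine ⟨(2⁻¹ : K) • β, fun b a₂ a₃ => ?_⟩
  change (2⁻¹ : K) • β (b * π a₂) a₃ - (2⁻¹ : K) • β b (a₂ * a₃) + (2⁻¹ : K) • β b a₂ * π a₃
    - b * π ((2⁻¹ : K) • P a₂ a₃) = 0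
  rw [map_smul, mul_smul_comm, ← hcocycle, smul_mul_assoc, ← smul_sub, ← smul_add, sub_self]

/-- An ideal whose quotient admits a first-order module deformation compatible with the
alternating form `½P` is coisotropic. -/
theorem coisotropic_of_module_deformation
    {K A : Type*} [Field K] [CharZero K] [CommRing A] [Algebra K A]
    (I : Ideal A) (P : A →ₗ[K] A →ₗ[K] A) (halt : ∀ a : A, P a a = 0)
    (αB : (A ⧸ I) →ₗ[K] A →ₗ[K] (A ⧸ I))
    (hα : ∀ (b : A ⧸ I) (a₂ a₃ : A),
      αB (b * Ideal.Quotient.mk I a₂) a₃ - αB b (a₂ * a₃)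
        + αB b a₂ * Ideal.Quotient.mk I a₃
        - b * Ideal.Quotient.mk I ((2⁻¹ : K) • P a₂ a₃) = 0) :
    ∀ x ∈ I, ∀ y ∈ I, P x y ∈ I := by
  have hP : ∀ x ∈ I, ∀ y ∈ I, Ideal.Quotient.mk I ((2⁻¹ : K) • P x y) = -αB 1 (x * y) := by
    intro x hx y hy
    have h := hα 1 x y
    rw [Ideal.Quotient.eq_zero_iff_mem.mpr hx, Ideal.Quotient.eq_zero_iff_mem.mpr hy] at h
    simp only [mul_zero, map_zero, LinearMap.zero_apply, one_mul, zero_sub, add_zero] at h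
    exact (sub_eq_zero.mp h).symm
  intro x hx y hy
  have hadd : P x y + P y x = 0 := by
    have h := halt (x + y)
    simp only [map_add, LinearMap.add_apply, halt, zero_add, add_zero] at h
    rw [add_comm]
    exact h
  have hsymm : Ideal.Quotient.mk I ((2⁻¹ : K) • P x y) =
      Ideal.Quotient.mk I ((2⁻¹ : K) • P y x) := by
    rw [hP x hx y hy, hP y hy x hx, mul_comm]
  have h : P x y = (2⁻¹ : K) • P x y - (2⁻¹ : K) • P y x := by
    rw [← smul_sub, eq_neg_of_add_eq_zero_right hadd, sub_neg_eq_add, ← two_smul K, smul_smul,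
      inv_mul_cancel₀ two_ne_zero, one_smul]
  rw [h, ← Ideal.Quotient.eq]
  exact hsymm

/-- Let `A` be a smooth (formally smooth, finite type) commutative
algebra over a field `K` of characteristic zero (coordinate ring of a smooth affine
variety `X`), `I ⊆ A` an ideal with `B := A/I` also smooth of finite type (coordinate
ring of a smooth closed subvariety `Y`), and `P` an alternating biderivation on `A`
(a bivector field).  Put `α_A := ½P`.  Then `Y` is coisotropic (`P(I,I) ⊆ I`) if and
only if there is a `K`-bilinear `α_B : B × A → B` with
`α_B(bπ(a₂),a₃) − α_B(b,a₂a₃) + α_B(b,a₂)π(a₃) − bπ(α_A(a₂,a₃)) = 0`, i.e. the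
first-order deformation of `A` determined by `α_A` admits a compatible first-order
deformation of `B` to a right module. -/
theorem coisotropic_iff_module_deformation_exists
    {K A : Type u} [Field K] [CharZero K] [CommRing A] [Algebra K A]
    [Algebra.FormallySmooth K A] [Algebra.FiniteType K A]
    (I : Ideal A)
    [Algebra.FormallySmooth K (A ⧸ I)] [Algebra.FiniteType K (A ⧸ I)]
    (P : A →ₗ[K] A →ₗ[K] A)
    (halt : ∀ a : A, P a a = 0)
    (hder₁ : ∀ a b c : A, P (a * b) c = a * P b c + b * P a c)
    (hder₂ : ∀ a b c : A, P a (b * c) = b * P a c + c * P a b) :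
    (∀ x ∈ I, ∀ y ∈ I, P x y ∈ I) ↔
      (∃ αB : (A ⧸ I) →ₗ[K] A →ₗ[K] (A ⧸ I),
        ∀ (b : A ⧸ I) (a₂ a₃ : A),
          αB (b * Ideal.Quotient.mk I a₂) a₃ - αB b (a₂ * a₃)
            + αB b a₂ * Ideal.Quotient.mk I a₃
            - b * Ideal.Quotient.mk I ((2⁻¹ : K) • P a₂ a₃) = 0) := by
  constructor
  · exact exists_module_deformation_of_coisotropic I P halt hder₁ hder₂
  · rintro ⟨αB, hα⟩
    exact coisotropic_of_module_deformation I P halt αB hα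
end

section
/- Let ℂ be a field of characteristic zero, A a commutative unital ℂ-algebra, I ⊆ A an ideal, B := A/I with quotient map π : A → B, and k ≥ 1. Let γ : B × A^k → B be a ℂ-multilinear map which is a Hochschild cocycle, i.e. for all b ∈ B and a₁,…,a_{k+1} ∈ A: γ(b·π(a₁), a₂,…,a_{k+1}) + Σ_{s=1}^{k}(−1)^s γ(b, a₁,…,a_s a_{s+1},…,a_{k+1}) + (−1)^{k+1} γ(b, a₁,…,a_k)·π(a_{k+1}) = 0. Define the antisymmetrization alt(γ)(b, x₁,…,x_k) := Σ_{σ ∈ S_k} sgn(σ)·γ(b, x_{σ(1)},…,x_{σ(k)}). Then: (1) alt(γ)(b, x₁,…,x_k) = 0 whenever x₁,…,x_k ∈ I and x_j ∈ I² for at least one j; and (2) for x₁,…,x_k ∈ I and any a ∈ A, alt(γ)(b, a x₁, x₂,…,x_k) = π(a)·alt(γ)(b, x₁,…,x_k) and alt(γ)(b, x₁,…,x_k) = b·alt(γ)(1, x₁,…,x_k); hence alt(γ) descends to a well-defined B-multilinear alternating map (I/I²)^k → B, i.e. a B-linear map Λ_B^k(I/I²) → B. -/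
open Finset

/-- The vector of length `n` obtained from `a : Fin (n+1) → A` by multiplying the
adjacent entries `a t` and `a (t+1)` (and keeping all other entries). -/
def mergeVec {A : Type*} [Mul A] {n : ℕ} (a : Fin (n + 1) → A) (t : Fin n) :
    Fin n → A :=
  fun i =>
    if (i : ℕ) < (t : ℕ) then a (Fin.castSucc i)
    else if i = t then a (Fin.castSucc i) * a i.succ
    else a i.succ

/-- The antisymmetrization of a multilinear cochain in its `A`-slots:
`alt(γ)(b, x₁,…,x_k) := Σ_{σ ∈ S_k} sgn(σ) γ(b, x_{σ(1)},…,x_{σ(k)})`. -/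
noncomputable def altMap {K A B : Type*} [Field K] [CommRing A] [Algebra K A]
    [CommRing B] [Algebra K B] {n : ℕ}
    (γ : B →ₗ[K] MultilinearMap K (fun _ : Fin n => A) B) (b : B) (x : Fin n → A) : B :=
  ∑ σ : Equiv.Perm (Fin n), (Equiv.Perm.sign σ : ℤ) • γ b (fun i => x (σ i))

/-- Multiplying two adjacent entries does not see their order. -/
theorem mergeVec_comp_swap {A : Type*} [CommRing A] {n : ℕ} (a : Fin (n + 1) → A) (t : Fin n) :
    mergeVec (fun i => a (Equiv.swap t.castSucc t.succ i)) t = mergeVec a t := by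
  funext i
  unfold mergeVec
  split_ifs with h1 h2
  · beta_reduce
    rw [Equiv.swap_apply_of_ne_of_ne] <;> simp [Fin.ext_iff] <;> omega
  · subst h2
    simp [mul_comm]
  · have h2' : (i : ℕ) ≠ t := fun h => h2 (Fin.ext h)
    beta_reduce
    rw [Equiv.swap_apply_of_ne_of_ne] <;> simp [Fin.ext_iff] <;> omega

theorem mergeVec_insertNth_castSucc {A : Type*} [CommRing A] {n : ℕ} (z : Fin n → A) (u : A)
    (t : Fin n) :
    mergeVec (Fin.insertNth (α := fun _ => A) t.castSucc u z) t
      = Function.update z t (u * z t) := by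
  funext i
  unfold mergeVec
  split_ifs with h1 h2
  · have : i.castSucc = t.castSucc.succAbove i := by
      rw [Fin.succAbove_of_castSucc_lt t.castSucc i (Fin.lt_def.mpr h1)]
    rw [this, Fin.insertNth_apply_succAbove, Function.update_of_ne (by rintro rfl; omega)]
  · subst h2
    have : i.succ = i.castSucc.succAbove i := by simp
    rw [this, Fin.insertNth_apply_succAbove, Fin.insertNth_apply_same, Function.update_self]
  · have : i.succ = t.castSucc.succAbove i := by
      rw [Fin.succAbove_of_le_castSucc t.castSucc i (Fin.le_def.mpr (not_lt.mp h1))]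
    rw [this, Fin.insertNth_apply_succAbove, Function.update_of_ne h2]

theorem mergeVec_insertNth_succ {A : Type*} [CommRing A] {n : ℕ} (z : Fin n → A) (u : A)
    (t : Fin n) :
    mergeVec (Fin.insertNth (α := fun _ => A) t.succ u z) t
      = Function.update z t (u * z t) := by
  rw [← mergeVec_insertNth_castSucc, ← mergeVec_comp_swap]
  congr 1
  funext i
  induction i using t.castSucc.succAboveCases with
  | x => simp
  | p j =>
    rw [Fin.insertNth_apply_succAbove]
    by_cases h : j = t
    · subst h
      have := Fin.insertNth_apply_succAbove (α := fun _ => A) j.succ u z j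
      simpa using this
    · have hj : (j : ℕ) ≠ t := fun e => h (Fin.ext e)
      have e : t.castSucc.succAbove j = t.succ.succAbove j := by
        rcases lt_or_gt_of_ne hj with hlt | hgt
        · rw [Fin.succAbove_of_castSucc_lt t.castSucc j (Fin.lt_def.mpr hlt),
            Fin.succAbove_of_castSucc_lt t.succ j (Fin.lt_def.mpr (by simp; omega))]
        · rw [Fin.succAbove_of_le_castSucc t.castSucc j (Fin.le_def.mpr (by simp; omega)),
            Fin.succAbove_of_le_castSucc t.succ j (Fin.le_def.mpr (by simp; omega))]
      rw [Equiv.swap_apply_of_ne_of_ne (Fin.succAbove_ne _ _), e,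
        Fin.insertNth_apply_succAbove]
      rw [e]
      exact Fin.succAbove_ne _ _

theorem altMap_eq_alternatization {K A B : Type*} [Field K] [CommRing A] [Algebra K A]
    [CommRing B] [Algebra K B] {n : ℕ}
    (γ : B →ₗ[K] MultilinearMap K (fun _ : Fin n => A) B) (b : B) (x : Fin n → A) :
    altMap γ b x = MultilinearMap.alternatization (γ b) x := by
  rw [MultilinearMap.alternatization_apply]
  rfl

/-- A weighted alternating sum over permutations of the cochain with two adjacent entries
multiplied vanishes when `u` is not one of these two entries and the weight only records
whether the letter `k` stands to the left or to the right of `u`. -/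
theorem sum_sign_smul_mergeVec_insertNth_eq_zero {A M : Type*} [CommRing A] [AddCommGroup M]
    {n : ℕ} (f : (Fin n → A) → M) (x : Fin n → A) (u : A) (k : Fin n) (α β : ℤ)
    (p : Fin (n + 1)) (t : Fin n) (h₁ : t.castSucc ≠ p) (h₂ : t.succ ≠ p) :
    ∑ σ : Equiv.Perm (Fin n),
      (if p < p.succAbove (σ.symm k) then α else β) • (Equiv.Perm.sign σ : ℤ) •
        f (mergeVec (Fin.insertNth (α := fun _ => A) p u (fun i => x (σ i))) t) = 0 := by
  obtain ⟨i, hi⟩ := Fin.exists_succAbove_eq h₁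
  obtain ⟨j, hj⟩ := Fin.exists_succAbove_eq h₂
  have hij : i ≠ j := by
    rintro rfl
    exact absurd (hi.symm.trans hj) (by simp [Fin.ext_iff])
  have hs : ∀ m, p.succAbove (Equiv.swap i j m)
      = Equiv.swap t.castSucc t.succ (p.succAbove m) := fun m => by
    rw [← hi, ← hj, ← (Fin.succAbove_right_injective (p := p)).map_swap]
  have hp : Equiv.swap t.castSucc t.succ p = p :=
    Equiv.swap_apply_of_ne_of_ne h₁.symm h₂.symm
  have hins : ∀ z : Fin n → A,
      Fin.insertNth (α := fun _ => A) p u (fun l => z (Equiv.swap i j l))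
        = fun l => Fin.insertNth (α := fun _ => A) p u z (Equiv.swap t.castSucc t.succ l) := by
    intro z
    funext l
    induction l using p.succAboveCases with
    | x => simp [hp]
    | p m => rw [← hs, Fin.insertNth_apply_succAbove, Fin.insertNth_apply_succAbove]
  have hlt : ∀ q, p < Equiv.swap t.castSucc t.succ q ↔ p < q := by
    intro q
    rw [Equiv.swap_apply_def]
    simp only [Fin.ext_iff, Fin.lt_def, ne_eq, Fin.val_castSucc, Fin.val_succ] at *
    split_ifs <;> simp <;> omega
  refine Finset.sum_involution (fun σ _ => σ * Equiv.swap i j) ?_ ?_ (by simp) ?_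
  · intro σ _
    have e : (σ * Equiv.swap i j).symm k = Equiv.swap i j (σ.symm k) := by
      rw [Equiv.symm_apply_eq]; simp
    rw [e, hs]
    simp only [hlt, Equiv.Perm.mul_apply]
    rw [hins (fun l => x (σ l)), mergeVec_comp_swap, Equiv.Perm.sign_mul,
      Equiv.Perm.sign_swap hij]
    simp
  · intro σ _ _ h
    exact hij (Equiv.swap_eq_one_iff.mp (mul_eq_left.mp h))
  · intro σ _
    rw [mul_assoc, Equiv.swap_mul_self, mul_one]

/-- The cocycle identity for all insertions of `u` into the permutations of `x`, summed with
weight `α` when the letter `k` stands to the right of `u` and with weight `β` otherwise. -/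
theorem weighted_sum_cocycle
    {K A : Type*} [Field K] [CommRing A] [Algebra K A] (I : Ideal A) {n : ℕ}
    (γ : (A ⧸ I) →ₗ[K] MultilinearMap K (fun _ : Fin n => A) (A ⧸ I))
    (hcocycle : ∀ (b : A ⧸ I) (a : Fin (n + 1) → A),
      γ (b * Ideal.Quotient.mk I (a 0)) (Fin.tail a)
        + ∑ t : Fin n, ((-1 : ℤ) ^ ((t : ℕ) + 1)) • γ b (mergeVec a t)
        + ((-1 : ℤ) ^ (n + 1)) •
            (γ b (Fin.init a) * Ideal.Quotient.mk I (a (Fin.last n))) = 0)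
    (b : A ⧸ I) (x : Fin n → A) (hx : ∀ i, x i ∈ I) (u : A) (k : Fin n) (α β : ℤ) :
    α • altMap γ (b * Ideal.Quotient.mk I u) x
      + (β - α) • altMap γ b (Function.update x k (u * x k))
      - β • (altMap γ b x * Ideal.Quotient.mk I u) = 0 := by
  have hmk : ∀ i, Ideal.Quotient.mk I (x i) = 0 := fun i =>
    Ideal.Quotient.eq_zero_iff_mem.mpr (hx i)
  let w : Fin (n + 1) → Equiv.Perm (Fin n) → ℤ := fun p σ =>
    if p < p.succAbove (σ.symm k) then α else β
  let c : Fin (n + 1) → Equiv.Perm (Fin n) → Fin (n + 1) → A := fun p σ =>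
    Fin.insertNth (α := fun _ => A) p u (fun i => x (σ i))
  have hfirst : ∑ p : Fin (n + 1), ∑ σ : Equiv.Perm (Fin n),
      ((-1 : ℤ) ^ (p : ℕ)) • w p σ • (Equiv.Perm.sign σ : ℤ) •
        γ (b * Ideal.Quotient.mk I (c p σ 0)) (Fin.tail (c p σ))
      = α • altMap γ (b * Ideal.Quotient.mk I u) x := by
    rw [Fintype.sum_eq_single 0, altMap, Finset.smul_sum]
    · refine Finset.sum_congr rfl fun σ _ => ?_
      simp [w, c]
    · intro p hp
      refine Finset.sum_eq_zero fun σ _ => ?_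
      obtain ⟨j, hj⟩ := Fin.exists_succAbove_eq hp.symm
      have : c p σ 0 = x (σ j) := by
        simp only [c]
        rw [← hj, Fin.insertNth_apply_succAbove]
      simp [this, hmk]
  have hlast : ∑ p : Fin (n + 1), ∑ σ : Equiv.Perm (Fin n),
      ((-1 : ℤ) ^ (p : ℕ)) • w p σ • (Equiv.Perm.sign σ : ℤ) • ((-1 : ℤ) ^ (n + 1)) •
        (γ b (Fin.init (c p σ)) * Ideal.Quotient.mk I (c p σ (Fin.last n)))
      = - β • (altMap γ b x * Ideal.Quotient.mk I u) := by
    rw [Fintype.sum_eq_single (Fin.last n), altMap, Finset.sum_mul, Finset.smul_sum]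
    · refine Finset.sum_congr rfl fun σ _ => ?_
      have hw : w (Fin.last n) σ = β := by
        simp [w, (Fin.castSucc_lt_last _).not_gt]
      have hc : c (Fin.last n) σ = Fin.snoc (α := fun _ => A) (fun i => x (σ i)) u := by
        simp only [c]
        rw [Fin.insertNth_last']
      rw [hw, hc, Fin.init_snoc, Fin.snoc_last, smul_mul_assoc]
      simp only [smul_smul, Fin.val_last]
      congr 1
      have : ((-1 : ℤ) ^ n) * (-1) ^ n = 1 := by rw [← mul_pow]; simp
      linear_combination (-β * (Equiv.Perm.sign σ : ℤ)) * this
    · intro p hp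
      refine Finset.sum_eq_zero fun σ _ => ?_
      obtain ⟨j, hj⟩ := Fin.exists_succAbove_eq hp.symm
      have : c p σ (Fin.last n) = x (σ j) := by
        simp only [c]
        rw [← hj, Fin.insertNth_apply_succAbove]
      simp [this, hmk]
  have hmid : ∑ p : Fin (n + 1), ∑ σ : Equiv.Perm (Fin n),
      ((-1 : ℤ) ^ (p : ℕ)) • w p σ • (Equiv.Perm.sign σ : ℤ) •
        ∑ t : Fin n, ((-1 : ℤ) ^ ((t : ℕ) + 1)) • γ b (mergeVec (c p σ) t)
      = (β - α) • altMap γ b (Function.update x k (u * x k)) := by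
    let m : Fin n → Fin (n + 1) → A ⧸ I := fun t p =>
      ∑ σ : Equiv.Perm (Fin n), w p σ • (Equiv.Perm.sign σ : ℤ) • γ b (mergeVec (c p σ) t)
    have hm : ∀ t p, t.castSucc ≠ p → t.succ ≠ p → m t p = 0 := fun t p h₁ h₂ =>
      sum_sign_smul_mergeVec_insertNth_eq_zero (fun a => γ b a) x u k α β p t h₁ h₂
    calc _ = ∑ t : Fin n, ∑ p : Fin (n + 1),
            ((-1 : ℤ) ^ (p : ℕ) * (-1 : ℤ) ^ ((t : ℕ) + 1)) • m t p := by
          rw [Finset.sum_comm (s := (Finset.univ : Finset (Fin n)))]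
          refine Finset.sum_congr rfl fun p _ => ?_
          simp only [m, Finset.smul_sum]
          rw [Finset.sum_comm]
          refine Finset.sum_congr rfl fun t _ => Finset.sum_congr rfl fun σ _ => ?_
          simp only [smul_smul]
          congr 1
          ring
      _ = ∑ t : Fin n, (m t t.succ - m t t.castSucc) := by
          refine Finset.sum_congr rfl fun t _ => ?_
          have hsq : ((-1 : ℤ) ^ (t : ℕ)) * (-1) ^ (t : ℕ) = 1 := by rw [← mul_pow]; simp
          rw [Fintype.sum_eq_add t.succ t.castSucc (by simp [Fin.ext_iff])
            (fun p hp => by rw [hm t p hp.2.symm hp.1.symm, smul_zero])]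
          simp only [Fin.val_succ, Fin.val_castSucc, pow_succ]
          rw [show ((-1 : ℤ) ^ (t : ℕ) * -1 * ((-1) ^ (t : ℕ) * -1)) = 1 by
              linear_combination hsq,
            show ((-1 : ℤ) ^ (t : ℕ) * ((-1) ^ (t : ℕ) * -1)) = -1 by
              linear_combination -hsq]
          simp [sub_eq_add_neg]
      _ = ∑ σ : Equiv.Perm (Fin n), ∑ t : Fin n,
            (w t.succ σ - w t.castSucc σ) • (Equiv.Perm.sign σ : ℤ) •
              γ b (Function.update (fun i => x (σ i)) t (u * x (σ t))) := by
          rw [Finset.sum_comm]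
          refine Finset.sum_congr rfl fun t _ => ?_
          simp only [m, c, mergeVec_insertNth_succ, mergeVec_insertNth_castSucc]
          rw [← Finset.sum_sub_distrib]
          exact Finset.sum_congr rfl fun σ _ => (sub_smul _ _ _).symm
      _ = _ := by
          rw [altMap, Finset.smul_sum]
          refine Finset.sum_congr rfl fun σ _ => ?_
          rw [Fintype.sum_eq_single (σ.symm k)]
          · have h₁ : w (σ.symm k).succ σ = β := by
              simp [w, Fin.lt_succAbove_iff_le_castSucc, Fin.le_def]
            have h₂ : w (σ.symm k).castSucc σ = α := by
              simp [w, Fin.lt_succAbove_iff_le_castSucc]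
            rw [h₁, h₂]
            congr 3
            funext i
            by_cases h : i = σ.symm k
            · subst h; simp
            · rw [Function.update_of_ne h, Function.update_of_ne]
              exact fun e => h (by rw [← e, Equiv.symm_apply_apply])
          · intro t ht
            have : w t.succ σ = w t.castSucc σ := by
              simp only [w, Fin.lt_succAbove_iff_le_castSucc]
              congr 1
              have : (t : ℕ) ≠ σ.symm k := fun e => ht (Fin.ext e)
              simp only [Fin.le_def, Fin.val_succ, Fin.val_castSucc, eq_iff_iff]
              omega
            rw [this, sub_self, zero_smul]
  rw [sub_eq_add_neg, ← neg_smul, ← hfirst, ← hmid, ← hlast]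
  simp only [← Finset.sum_add_distrib, ← smul_add]
  refine Finset.sum_eq_zero fun p _ => Finset.sum_eq_zero fun σ _ => ?_
  rw [hcocycle b (c p σ)]
  simp

/-- (Explicit Hochschild–Kostant–Rosenberg antisymmetrization.)
Let `K` be a field of characteristic zero, `A` a commutative unital `K`-algebra,
`I ⊆ A` an ideal, `B := A/I`, and `γ : B × A^k → B` a `K`-multilinear Hochschild cocycle
(`k ≥ 1`).  Then the antisymmetrization `alt(γ)` (1) vanishes whenever all slots lie in
`I` and at least one slot lies in `I²`, and (2) is `B`-linear in each slot and in `b` on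
`I`-tuples; hence it descends to a `B`-linear map `Λ_B^k(I/I²) → B`. -/
theorem hkr_antisymmetrization_descends
    {K A : Type*} [Field K] [CharZero K] [CommRing A] [Algebra K A]
    (I : Ideal A) {n : ℕ} (hn : 0 < n)
    (γ : (A ⧸ I) →ₗ[K] MultilinearMap K (fun _ : Fin n => A) (A ⧸ I))
    (hcocycle : ∀ (b : A ⧸ I) (a : Fin (n + 1) → A),
      γ (b * Ideal.Quotient.mk I (a 0)) (Fin.tail a)
        + ∑ t : Fin n, ((-1 : ℤ) ^ ((t : ℕ) + 1)) • γ b (mergeVec a t)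
        + ((-1 : ℤ) ^ (n + 1)) •
            (γ b (Fin.init a) * Ideal.Quotient.mk I (a (Fin.last n))) = 0) :
    (∀ (b : A ⧸ I) (x : Fin n → A), (∀ i, x i ∈ I) →
        ∀ j, x j ∈ I ^ 2 → altMap γ b x = 0) ∧
      (∀ (b : A ⧸ I) (x : Fin n → A), (∀ i, x i ∈ I) → ∀ a : A,
        altMap γ b (Function.update x ⟨0, hn⟩ (a * x ⟨0, hn⟩))
          = Ideal.Quotient.mk I a * altMap γ b x) ∧
      (∀ (b : A ⧸ I) (x : Fin n → A), (∀ i, x i ∈ I) →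
        altMap γ b x = b * altMap γ 1 x) := by
  have hleft : ∀ (b : A ⧸ I) (x : Fin n → A), (∀ i, x i ∈ I) → ∀ (u : A) (k : Fin n),
      altMap γ b (Function.update x k (u * x k)) = altMap γ (b * Ideal.Quotient.mk I u) x := by
    intro b x hx u k
    have := weighted_sum_cocycle I γ hcocycle b x hx u k 1 0
    simp only [one_smul, zero_smul, zero_sub, neg_smul, sub_zero] at this
    exact (add_neg_eq_zero.mp this).symm
  have hright : ∀ (b : A ⧸ I) (x : Fin n → A), (∀ i, x i ∈ I) → ∀ (u : A) (k : Fin n),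
      altMap γ b (Function.update x k (u * x k)) = altMap γ b x * Ideal.Quotient.mk I u := by
    intro b x hx u k
    have := weighted_sum_cocycle I γ hcocycle b x hx u k 0 1
    simp only [one_smul, zero_smul, zero_add, sub_zero] at this
    exact sub_eq_zero.mp this
  refine ⟨fun b x hx j hj => ?_, fun b x hx a => ?_, fun b x hx => ?_⟩
  · have key : ∀ y ∈ I ^ 2, altMap γ b (Function.update x j y) = 0 := by
      intro y hy
      rw [pow_two] at hy
      induction hy using Submodule.mul_induction_on' with
      | mem_mul_mem u hu v hv =>
        have := hright b (Function.update x j v)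
          (fun i => by
            rcases eq_or_ne i j with rfl | h
            · simpa using hv
            · simpa [h] using hx i) u j
        rw [Function.update_self, Function.update_idem,
          Ideal.Quotient.eq_zero_iff_mem.mpr hu, mul_zero] at this
        exact this
      | add y _ z _ hy hz =>
        rw [altMap_eq_alternatization] at hy hz ⊢
        rw [AlternatingMap.map_update_add, hy, hz, add_zero]
    simpa using key (x j) hj
  · rw [hright b x hx, mul_comm]
  · obtain ⟨u, rfl⟩ := Ideal.Quotient.mk_surjective b
    rw [mul_comm, ← hright 1 x hx u ⟨0, hn⟩, hleft 1 x hx, one_mul]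
end
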